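/- If the evaluation parameters a_1, …, a_p are pairwise distinct, then dim_ℂ R_a(λ) ≥ d! / ((λ^t_1)! ⋯ (λ^t_p)!). -/

import Mathlib

open MvPolynomial

noncomputable section

/-- Complete homogeneous symmetric function `h_k` of a list of complex numbers. -/
def hcomp : ℕ → List ℂ → ℂ
  | 0, _ => 1
  | _ + 1, [] => 0
  | k + 1, x :: l => x * hcomp k (x :: l) + hcomp (k + 1) l
  termination_by k l => (l.length, k)

/-- Elementary symmetric polynomial `e_r` in the variables indexed by `J ⊆ {1,…,d}`. -/
def elemSym (d : ℕ) (J : Finset (Fin d)) (r : ℕ) : MvPolynomial (Fin d) ℂ :=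
  ∑ s ∈ J.powersetCard r, ∏ j ∈ s, X j

/-- The tuple `a^{(n)}` : entries `a_1,…,a_{λ_i}` for each row `i = n+1,…,ℓ` (0-indexed rows). -/
def aTuple (ℓ : ℕ) (lam : ℕ → ℕ) (a : ℕ → ℂ) (n : ℕ) : List ℂ :=
  ((List.range ℓ).drop n).flatMap fun i => (List.range (lam i)).map a

/-- `m_λ(n) = λ_{n+1} + … + λ_ℓ` (0-indexed rows `n,…,ℓ-1`). -/
def mRem (ℓ : ℕ) (lam : ℕ → ℕ) (n : ℕ) : ℕ := ∑ i ∈ Finset.Ico n ℓ, lam i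

/-- The deformed Tanisaki generator `g_{n,J,r} = Σ_{k=0}^r (−1)^k e_{r−k}(t_J) h_k(a^{(n)})`. -/
def tanGen (d ℓ : ℕ) (lam : ℕ → ℕ) (a : ℕ → ℂ) (n : ℕ) (J : Finset (Fin d)) (r : ℕ) :
    MvPolynomial (Fin d) ℂ :=
  ∑ k ∈ Finset.range (r + 1), C ((-1) ^ k * hcomp k (aTuple ℓ lam a n)) * elemSym d J (r - k)

/-- The deformed Tanisaki ideal `⟨𝒞^a_λ⟩`. -/
def tanIdeal (d ℓ : ℕ) (lam : ℕ → ℕ) (a : ℕ → ℂ) : Ideal (MvPolynomial (Fin d) ℂ) :=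
  Ideal.span {g | ∃ n J r, n < ℓ ∧ J.card = d - n ∧
    d - n - mRem ℓ lam n < r ∧ r ≤ d - n ∧ g = tanGen d ℓ lam a n J r}

/-- `lam 0, lam 1, …, lam (ℓ-1)` is a partition of `d` with `ℓ` positive parts. -/
def IsPartitionOf (d ℓ : ℕ) (lam : ℕ → ℕ) : Prop :=
  0 < ℓ ∧ (∀ i j, i ≤ j → lam j ≤ lam i) ∧ (∀ i < ℓ, 0 < lam i) ∧
    (∀ i, ℓ ≤ i → lam i = 0) ∧ ∑ i ∈ Finset.range ℓ, lam i = d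

/-- `λ^t_i = #{rows j with λ_j ≥ i}` (here `i ≥ 1`). -/
def lamT (ℓ : ℕ) (lam : ℕ → ℕ) (i : ℕ) : ℕ :=
  ((Finset.range ℓ).filter fun j => i ≤ lam j).card

/-- The deformed Tanisaki–Garsia–Procesi algebra `R_a(λ)`. -/
abbrev TGPAlg (d ℓ : ℕ) (lam : ℕ → ℕ) (a : ℕ → ℂ) :=
  MvPolynomial (Fin d) ℂ ⧸ tanIdeal d ℓ lam a


/-- generating series of the signed complete homogeneous functions -/
def hSer (l : List ℂ) : PowerSeries ℂ := PowerSeries.mk fun k => (-1) ^ k * hcomp k l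

/-- generating series of the elementary symmetric functions -/
def eSer (m : Multiset ℂ) : PowerSeries ℂ := (m.map fun x => 1 + PowerSeries.C x * PowerSeries.X).prod

lemma hcomp_zero' (l : List ℂ) : hcomp 0 l = 1 := by
  unfold hcomp; rfl

lemma hSer_nil : hSer [] = 1 := by
  ext k
  cases k with
  | zero => simp [hSer, hcomp_zero']
  | succ k => simp [hSer, hcomp, PowerSeries.coeff_one]

lemma hSer_cons (x : ℂ) (l : List ℂ) :
    hSer (x :: l) * (1 + PowerSeries.C x * PowerSeries.X) = hSer l := by
  ext k
  have e : hSer (x :: l) * (1 + PowerSeries.C x * PowerSeries.X)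
      = hSer (x :: l) + PowerSeries.C x * (hSer (x :: l) * PowerSeries.X) := by ring
  rw [e]
  cases k with
  | zero => simp [hSer, hcomp_zero']
  | succ k =>
    rw [map_add, PowerSeries.coeff_C_mul, PowerSeries.coeff_succ_mul_X]
    simp only [hSer, PowerSeries.coeff_mk]
    rw [show hcomp (k + 1) (x :: l) = x * hcomp k (x :: l) + hcomp (k + 1) l by rw [hcomp]]
    ring

lemma hSer_mul_eSer (l : List ℂ) (s : Multiset ℂ) :
    hSer l * eSer ((l : Multiset ℂ) + s) = eSer s := by
  induction l with
  | nil => simp [hSer_nil]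
  | cons x l ih =>
    rw [← Multiset.cons_coe, Multiset.cons_add, eSer, Multiset.map_cons, Multiset.prod_cons,
      ← mul_assoc, hSer_cons]
    exact ih

lemma eSer_finset {ι : Type*} (J : Finset ι) (t : ι → ℂ) (r : ℕ) :
    PowerSeries.coeff r (eSer (J.val.map t)) = ∑ s ∈ J.powersetCard r, ∏ j ∈ s, t j := by
  classical
  have : eSer (J.val.map t) = ∏ j ∈ J, (1 + PowerSeries.C (t j) * PowerSeries.X) := by
    rw [eSer, Multiset.map_map]; rfl
  rw [this, Finset.prod_one_add, map_sum, ← Finset.sum_filter_add_sum_filter_not _ (fun s => s.card = r)]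
  rw [← Finset.powersetCard_eq_filter]
  rw [Finset.sum_eq_zero (s := Finset.filter _ _), add_zero]
  · apply Finset.sum_congr rfl
    intro s hs
    rw [Finset.prod_mul_distrib, Finset.prod_const, ← map_prod, PowerSeries.coeff_C_mul,
      PowerSeries.coeff_X_pow, (Finset.mem_powersetCard.1 hs).2]
    simp
  · intro s hs
    rw [Finset.prod_mul_distrib, Finset.prod_const, ← map_prod, PowerSeries.coeff_C_mul,
      PowerSeries.coeff_X_pow, if_neg (Ne.symm (Finset.mem_filter.1 hs).2), mul_zero]

lemma eSer_coeff_big (m : Multiset ℂ) : ∀ r, m.card < r → PowerSeries.coeff r (eSer m) = 0 := by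
  induction m using Multiset.induction_on with
  | empty =>
    intro r hr
    simp only [Multiset.card_zero] at hr
    simp [eSer, PowerSeries.coeff_one, hr.ne']
  | cons x m ih =>
    intro r hr
    rw [Multiset.card_cons] at hr
    obtain ⟨r, rfl⟩ : ∃ q, r = q + 1 := ⟨r - 1, by omega⟩
    have e : eSer (x ::ₘ m) = eSer m + PowerSeries.C x * (eSer m * PowerSeries.X) := by
      rw [eSer, Multiset.map_cons, Multiset.prod_cons, ← eSer]; ring
    rw [e, map_add, PowerSeries.coeff_C_mul, PowerSeries.coeff_succ_mul_X, ih _ (by omega),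
      ih _ (by omega)]
    simp

lemma vanish {ι : Type*} (J : Finset ι) (t : ι → ℂ) (l : List ℂ)
    (hl : (l : Multiset ℂ) ≤ J.val.map t) (r : ℕ) (hr : J.card - l.length < r) :
    ∑ k ∈ Finset.range (r + 1), ((-1) ^ k * hcomp k l) *
      ∑ s ∈ J.powersetCard (r - k), ∏ j ∈ s, t j = 0 := by
  obtain ⟨s, hs⟩ := Multiset.le_iff_exists_add.1 hl
  have h1 := hSer_mul_eSer l s
  rw [← hs] at h1
  have hc : s.card < r := by
    have := congrArg Multiset.card hs
    simp at this
    omega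
  have h2 := congrArg (PowerSeries.coeff r) h1
  rw [eSer_coeff_big s r hc, PowerSeries.coeff_mul,
    Finset.Nat.sum_antidiagonal_eq_sum_range_succ_mk] at h2
  rw [← h2]
  apply Finset.sum_congr rfl
  intro k _
  rw [eSer_finset]
  simp [hSer]

/-- indices appearing in `aTuple` -/
def iTuple (ℓ : ℕ) (lam : ℕ → ℕ) (n : ℕ) : List ℕ :=
  ((List.range ℓ).drop n).flatMap fun i => List.range (lam i)

lemma aTuple_eq (ℓ : ℕ) (lam : ℕ → ℕ) (a : ℕ → ℂ) (n : ℕ) :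
    aTuple ℓ lam a n = (iTuple ℓ lam n).map a := by
  simp [aTuple, iTuple, List.map_flatMap]

lemma drop_range_sum (ℓ n : ℕ) (f : ℕ → ℕ) :
    (((List.range ℓ).drop n).map f).sum = ∑ i ∈ Finset.Ico n ℓ, f i := by
  rw [List.range_eq_range', List.drop_range']
  simp only [mul_one, zero_add]
  rfl

lemma iTuple_length (ℓ : ℕ) (lam : ℕ → ℕ) (n : ℕ) :
    (iTuple ℓ lam n).length = mRem ℓ lam n := by
  rw [iTuple, List.length_flatMap, mRem, ← drop_range_sum]
  simp

lemma iTuple_count (ℓ : ℕ) (lam : ℕ → ℕ) (n j : ℕ) :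
    (iTuple ℓ lam n).count j = ((Finset.Ico n ℓ).filter fun i => j < lam i).card := by
  rw [iTuple, List.count_flatMap, drop_range_sum, Finset.card_filter]
  apply Finset.sum_congr rfl
  intro i _
  simp [List.nodup_range.count]

lemma iTuple_count_le (ℓ : ℕ) (lam : ℕ → ℕ) (hm : ∀ i j, i ≤ j → lam j ≤ lam i) (n j : ℕ) :
    (iTuple ℓ lam n).count j ≤ (iTuple ℓ lam 0).count j - n := by
  rw [iTuple_count, iTuple_count]
  rcases Finset.eq_empty_or_nonempty ((Finset.Ico n ℓ).filter fun i => j < lam i) with h | h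
  · simp [h]
  · obtain ⟨i, hi⟩ := h
    simp only [Finset.mem_filter, Finset.mem_Ico] at hi
    have hsub : Finset.range n ∪ ((Finset.Ico n ℓ).filter fun i => j < lam i) ⊆
        (Finset.Ico 0 ℓ).filter fun i => j < lam i := by
      intro q hq
      simp only [Finset.mem_union, Finset.mem_range, Finset.mem_filter, Finset.mem_Ico] at hq ⊢
      rcases hq with hq | hq
      · have := hm q i (by omega)
        omega
      · omega
    have hd : Disjoint (Finset.range n) ((Finset.Ico n ℓ).filter fun i => j < lam i) := by
      rw [Finset.disjoint_left]
      intro q hq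
      simp only [Finset.mem_range, Finset.mem_filter, Finset.mem_Ico] at hq ⊢
      omega
    have := Finset.card_le_card hsub
    rw [Finset.card_union_of_disjoint hd, Finset.card_range] at this
    omega

lemma sub_multiset {d : ℕ} (ℓ : ℕ) (lam : ℕ → ℕ) (hm : ∀ i j, i ≤ j → lam j ≤ lam i)
    (g : Fin d → ℕ) (hg : (Finset.univ : Finset (Fin d)).val.map g = (iTuple ℓ lam 0 : Multiset ℕ))
    (n : ℕ) (J : Finset (Fin d)) (hJ : J.card = d - n) :
    (iTuple ℓ lam n : Multiset ℕ) ≤ J.val.map g := by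
  rw [Multiset.le_iff_count]
  intro j
  have h1 := iTuple_count_le ℓ lam hm n j
  have h2 : (Finset.univ : Finset (Fin d)).val = J.val + Jᶜ.val := by
    have := Finset.disjUnion_eq_union J Jᶜ disjoint_compl_right
    rw [Finset.union_compl] at this
    rw [← this]; rfl
  have h3 := congrArg (Multiset.count j) hg
  rw [h2, Multiset.map_add, Multiset.count_add, Multiset.coe_count] at h3
  have h4 := Multiset.count_le_card j (Jᶜ.val.map g)
  have h5 : Jᶜ.card = d - J.card := by simp [Finset.card_compl]
  rw [Multiset.card_map, Finset.card_val] at h4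
  rw [Multiset.coe_count]
  omega

lemma eval_tanIdeal {d : ℕ} (ℓ : ℕ) (lam : ℕ → ℕ) (hm : ∀ i j, i ≤ j → lam j ≤ lam i)
    (a : ℕ → ℂ) (g : Fin d → ℕ)
    (hg : (Finset.univ : Finset (Fin d)).val.map g = (iTuple ℓ lam 0 : Multiset ℕ))
    (q : MvPolynomial (Fin d) ℂ) (hq : q ∈ tanIdeal d ℓ lam a) :
    eval (fun i => a (g i)) q = 0 := by
  have : tanIdeal d ℓ lam a ≤ RingHom.ker (eval (fun i => a (g i))) := by
    rw [tanIdeal, Ideal.span_le]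
    rintro _ ⟨n, J, r, hn, hJ, hr, hr', rfl⟩
    simp only [SetLike.mem_coe, RingHom.mem_ker]
    have h := Multiset.map_le_map (f := a) (sub_multiset ℓ lam hm g hg n J hJ)
    rw [Multiset.map_map, Multiset.map_coe, ← aTuple_eq] at h
    have hv := vanish J (a ∘ g) _ h r
      (by rw [aTuple_eq, List.length_map, iTuple_length, hJ]; exact hr)
    rw [tanGen, map_sum, ← hv]
    apply Finset.sum_congr rfl
    intro k _
    rw [map_mul, eval_C, elemSym, map_sum]
    simp
  exact this hq

/-- finitely many points impose independent conditions -/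
lemma rank_ge_of_points {d : ℕ} (I : Ideal (MvPolynomial (Fin d) ℂ)) (P : Type) [Fintype P]
    (t : P → Fin d → ℂ) (ht : Function.Injective t) (hI : ∀ x, ∀ q ∈ I, eval (t x) q = 0) :
    (Fintype.card P : Cardinal) ≤ Module.rank ℂ (MvPolynomial (Fin d) ℂ ⧸ I) := by
  classical
  let φ : MvPolynomial (Fin d) ℂ →ₐ[ℂ] (P → ℂ) := AlgHom.pi fun x => aeval (t x)
  have hφ : ∀ q x, φ q x = eval (t x) q := fun q x => by
    simp [φ]
  let ψ : (MvPolynomial (Fin d) ℂ ⧸ I) →ₐ[ℂ] (P → ℂ) :=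
    Ideal.Quotient.liftₐ I φ (fun q hq => by ext x; rw [hφ, hI x q hq]; rfl)
  have hsep : ∀ x y : P, ∃ q : MvPolynomial (Fin d) ℂ,
      x ≠ y → eval (t x) q ≠ 0 ∧ eval (t y) q = 0 := by
    intro x y
    by_cases h : x = y
    · exact ⟨0, fun h' => absurd h h'⟩
    · obtain ⟨i, hi⟩ := Function.ne_iff.1 (fun e => h (ht e))
      exact ⟨X i - C (t y i), fun _ => by simp [sub_eq_zero, hi]⟩
  choose q hq using hsep
  let L : P → MvPolynomial (Fin d) ℂ := fun x => ∏ y ∈ Finset.univ.erase x, q x y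
  have hL1 : ∀ x, eval (t x) (L x) ≠ 0 := by
    intro x
    simp only [L, map_prod]
    rw [Finset.prod_ne_zero_iff]
    intro y hy
    exact (hq x y (Finset.ne_of_mem_erase hy).symm).1
  have hL2 : ∀ x y, x ≠ y → eval (t y) (L x) = 0 := by
    intro x y hxy
    simp only [L, map_prod]
    exact Finset.prod_eq_zero (Finset.mem_erase.2 ⟨hxy.symm, Finset.mem_univ y⟩) (hq x y hxy).2
  have hsurj : Function.Surjective ψ.toLinearMap := by
    intro v
    refine ⟨Ideal.Quotient.mk I (∑ x, C (v x / eval (t x) (L x)) * L x), ?_⟩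
    have e : ψ.toLinearMap (Ideal.Quotient.mk I (∑ x, C (v x / eval (t x) (L x)) * L x))
        = φ (∑ x, C (v x / eval (t x) (L x)) * L x) := rfl
    rw [e]
    ext y
    rw [hφ, map_sum, Finset.sum_eq_single y]
    · rw [map_mul, eval_C, div_mul_cancel₀ _ (hL1 y)]
    · intro x _ hxy
      rw [map_mul, hL2 x y hxy, mul_zero]
    · simp
  have := LinearMap.rank_le_of_surjective ψ.toLinearMap hsurj
  rwa [rank_fun'] at this

lemma exists_enum (d : ℕ) (L : List ℕ) (h : L.length = d) :
    ∃ f : Fin d → ℕ, (Finset.univ : Finset (Fin d)).val.map f = (L : Multiset ℕ) := by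
  subst h
  exact ⟨L.get, by rw [Fin.univ_val_map, List.ofFn_get]⟩

lemma orbit_count {d : ℕ} (f : Fin d → ℕ) :
    Nat.card (MulAction.orbit (Equiv.Perm (Fin d))ᵈᵐᵃ f) *
      ∏ i ∈ Finset.univ.image f, (Fintype.card {b // f b = i}).factorial = d.factorial := by
  classical
  have hst' := DomMulAct.stabilizer_card' f
  rw [← Nat.card_eq_fintype_card] at hst'
  have hst2 : Nat.card (MulAction.stabilizer (Equiv.Perm (Fin d))ᵈᵐᵃ f) = Nat.card {g : Equiv.Perm (Fin d) // f ∘ g = f} :=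
    Nat.card_congr (Equiv.subtypeEquiv DomMulAct.mk.symm fun g => DomMulAct.mem_stabilizer_iff)
  have hG : Nat.card (Equiv.Perm (Fin d))ᵈᵐᵃ = d.factorial := by
    rw [Nat.card_congr (DomMulAct.mk (M := Equiv.Perm (Fin d))).symm, Nat.card_eq_fintype_card,
      Fintype.card_perm, Fintype.card_fin]
  have horb := Nat.card_congr (MulAction.orbitProdStabilizerEquivGroup (Equiv.Perm (Fin d))ᵈᵐᵃ f)
  rw [Nat.card_prod, hG, hst2, hst'] at horb
  exact horb

lemma map_perm_univ {d : ℕ} (f : Fin d → ℕ) (σ : Equiv.Perm (Fin d)) :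
    (Finset.univ : Finset (Fin d)).val.map (f ∘ σ) = (Finset.univ : Finset (Fin d)).val.map f := by
  rw [← Multiset.map_map]
  have h := congrArg Finset.val (Finset.map_univ_equiv σ)
  rw [Finset.map_val] at h
  exact congrArg (Multiset.map f) h

lemma rank_ge_orbit {d : ℕ} (ℓ : ℕ) (lam : ℕ → ℕ) (hm : ∀ i j, i ≤ j → lam j ≤ lam i) (a : ℕ → ℂ)
    (hdist : ∀ i j, i < lam 0 → j < lam 0 → i ≠ j → a i ≠ a j) (f : Fin d → ℕ)
    (hf : (Finset.univ : Finset (Fin d)).val.map f = (iTuple ℓ lam 0 : Multiset ℕ))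
    (hlt : ∀ i, f i < lam 0) (P : Set (Fin d → ℕ))
    (hP : ∀ x : P, ∃ σ : Equiv.Perm (Fin d), (x : Fin d → ℕ) = f ∘ σ) :
    (Nat.card P : Cardinal) ≤ Module.rank ℂ (TGPAlg d ℓ lam a) := by
  have hfinP : Finite P := by
    choose σ hσ using hP
    refine Finite.of_injective σ fun x y h => Subtype.ext ?_
    rw [hσ x, hσ y, h]
  have : Fintype P := Fintype.ofFinite P
  let tt : P → Fin d → ℂ := fun x i => a ((x : Fin d → ℕ) i)
  have htinj : Function.Injective tt := by
    intro x y hxy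
    apply Subtype.ext
    funext i
    obtain ⟨σ, hσ⟩ := hP x
    obtain ⟨τ, hτ⟩ := hP y
    by_contra hne
    refine hdist _ _ ?_ ?_ hne (congrFun hxy i)
    · rw [hσ]; exact hlt _
    · rw [hτ]; exact hlt _
  have hv : ∀ x : P, ∀ q ∈ tanIdeal d ℓ lam a, eval (tt x) q = 0 := by
    intro x q hq
    obtain ⟨σ, hσ⟩ := hP x
    refine eval_tanIdeal ℓ lam hm a (x : Fin d → ℕ) ?_ q hq
    rw [hσ, map_perm_univ, hf]
  rw [Nat.card_eq_fintype_card]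
  exact rank_ge_of_points (tanIdeal d ℓ lam a) P tt htinj hv

/-- if the evaluation parameters `a_1,…,a_p` are pairwise distinct then
`dim_ℂ R_a(λ) ≥ d!/((λ^t_1)!⋯(λ^t_p)!)`. -/
theorem deformed_TGP_dim_lower_bound (d ℓ : ℕ) (lam : ℕ → ℕ)
    (hpart : IsPartitionOf d ℓ lam) (a : ℕ → ℂ)
    (hdist : ∀ i j, i < lam 0 → j < lam 0 → i ≠ j → a i ≠ a j) :
    ((Nat.factorial d / ∏ i ∈ Finset.range (lam 0), Nat.factorial (lamT ℓ lam (i + 1)) : ℕ) :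
        Cardinal) ≤ Module.rank ℂ (TGPAlg d ℓ lam a) := by
  classical
  obtain ⟨hl, hm, hpos, hz, hsum⟩ := hpart
  have hlen : (iTuple ℓ lam 0).length = d := by
    rw [iTuple_length, mRem, ← hsum, Finset.range_eq_Ico]
  obtain ⟨f, hf⟩ := exists_enum d _ hlen
  have hcount : ∀ j, Fintype.card {i // f i = j} = lamT ℓ lam (j + 1) := by
    intro j
    have h := congrArg (Multiset.count j) hf
    rw [Multiset.coe_count, iTuple_count, Multiset.count_map] at h
    rw [Fintype.card_subtype, lamT, Finset.range_eq_Ico]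
    refine Eq.trans ?_ h
    rw [Finset.card_def, Finset.filter_val]
    simp only [eq_comm]
  have hlt : ∀ i, f i < lam 0 := by
    intro i
    have hmem : f i ∈ (iTuple ℓ lam 0 : Multiset ℕ) := by
      rw [← hf]
      exact Multiset.mem_map_of_mem f (Finset.mem_univ i)
    simp only [iTuple, Multiset.mem_coe, List.mem_flatMap, List.mem_range] at hmem
    obtain ⟨r, _, hr⟩ := hmem
    exact lt_of_lt_of_le hr (hm 0 r (Nat.zero_le r))

  have hfin := rank_ge_orbit ℓ lam hm a hdist f hf hlt (MulAction.orbit (Equiv.Perm (Fin d))ᵈᵐᵃ f) (by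
    rintro ⟨_, g, rfl⟩
    exact ⟨DomMulAct.mk.symm g, rfl⟩)
  refine le_trans ?_ hfin
  rw [Nat.cast_le]
  have horb := orbit_count f
  have hprod : ∏ i ∈ Finset.univ.image f, (Fintype.card {b // f b = i}).factorial =
      ∏ i ∈ Finset.range (lam 0), (lamT ℓ lam (i + 1)).factorial := by
    simp only [hcount]
    apply Finset.prod_subset
    · intro j hj
      obtain ⟨i, _, rfl⟩ := Finset.mem_image.1 hj
      exact Finset.mem_range.2 (hlt i)
    · intro j _ hj
      rw [← hcount j]
      have : IsEmpty {b // f b = j} :=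
        ⟨fun b => hj (Finset.mem_image.2 ⟨b.1, Finset.mem_univ _, b.2⟩)⟩
      rw [Fintype.card_eq_zero, Nat.factorial_zero]
  rw [hprod] at horb
  rw [← horb, Nat.mul_div_cancel _ (Finset.prod_pos fun i _ => Nat.factorial_pos _)]

end
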